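/- Let λ > 0 and let (α_n)_{n≥0} be a sequence with 0 < α_n ≤ 1 for all n. For n ≥ 0 and t ≥ 0 define p(n,t) = (−1)^n ∑_{k=n}^∞ (−λ)^k ∑_{(k_0,…,k_n) ∈ Θ^k_n} t^{∑_{j=0}^n k_j α_j} / Γ(1 + ∑_{j=0}^n k_j α_j), and set p(−1,t) = 0. Then for every n ≥ 0 and every t ≥ 0, p(n,t) = [n=0] − λ · (I^{α_n}_t p(n,·))(t) + λ · (I^{α_n}_t p(n−1,·))(t), where [n=0] equals 1 if n = 0 and 0 otherwise. (In particular p(0,0) = 1 and p(n,0) = 0 for n ≥ 1.) -/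

import Mathlib

open scoped BigOperators

/-- Riemann–Liouville fractional integral of order `α`. -/
noncomputable def rlInt (α : ℝ) (f : ℝ → ℝ) (t : ℝ) : ℝ :=
  (1 / Real.Gamma α) * ∫ s in (0:ℝ)..t, (t - s) ^ (α - 1) * f s

/-- `Theta n k` is the set of tuples `(k_0, …, k_n)` of nonnegative integers with
`k_0 + ⋯ + k_n = k` and `k_j ≥ 1` for `1 ≤ j ≤ n`. -/
def Theta (n k : ℕ) : Finset (Fin (n + 1) → ℕ) :=
  (Finset.Nat.antidiagonalTuple (n + 1) k).filter
    (fun κ => ∀ j : Fin (n + 1), 1 ≤ j.val → 1 ≤ κ j)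

/-- The state probabilities of SDTFPP-I (note that `Theta n k = ∅` for `k < n`,
so the series over all `k : ℕ` agrees with the series starting at `k = n`). -/
noncomputable def pI (lam : ℝ) (α : ℕ → ℝ) (n : ℕ) (t : ℝ) : ℝ :=
  (-1 : ℝ) ^ n * ∑' k : ℕ, (-lam) ^ k *
    ∑ κ ∈ Theta n k,
      t ^ (∑ j, (κ j : ℝ) * α j.val) / Real.Gamma (1 + ∑ j, (κ j : ℝ) * α j.val)

open MeasureTheory Set in
/-- `Γ(1 + s) ≥ R ^ s * e ^ (-R)`, from restricting the Euler integral to `(R, ∞)`. -/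
theorem rpow_div_Gamma_le_exp {R s : ℝ} (hR : 0 < R) (hs : 0 ≤ s) :
    R ^ s / Real.Gamma (1 + s) ≤ Real.exp R := by
  have hpos : 0 < 1 + s := by linarith
  have hG : R ^ s * Real.exp (-R) ≤ Real.Gamma (1 + s) := by
    rw [Real.Gamma_eq_integral hpos, ← integral_exp_neg_Ioi, ← integral_const_mul]
    have hint := Real.GammaIntegral_convergent hpos
    calc ∫ x in Ioi R, R ^ s * Real.exp (-x)
        ≤ ∫ x in Ioi R, Real.exp (-x) * x ^ (1 + s - 1) := by
          refine setIntegral_mono_on ((integrableOn_exp_neg_Ioi R).const_mul _)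
            (hint.mono_set (Ioi_subset_Ioi hR.le)) measurableSet_Ioi fun x hx => ?_
          rw [mul_comm, add_sub_cancel_left]
          exact mul_le_mul_of_nonneg_left
            (Real.rpow_le_rpow hR.le (le_of_lt hx) hs) (Real.exp_pos _).le
      _ ≤ ∫ x in Ioi 0, Real.exp (-x) * x ^ (1 + s - 1) := by
          refine setIntegral_mono_set hint ?_ (Ioi_subset_Ioi hR.le).eventuallyLE
          filter_upwards [self_mem_ae_restrict measurableSet_Ioi] with x hx
          exact mul_nonneg (Real.exp_pos _).le (Real.rpow_nonneg (le_of_lt hx) _)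
  rw [div_le_iff₀ (Real.Gamma_pos_of_pos hpos)]
  calc R ^ s = Real.exp R * (R ^ s * Real.exp (-R)) := by
        rw [mul_left_comm, ← Real.exp_add]; simp
    _ ≤ _ := mul_le_mul_of_nonneg_left hG (Real.exp_pos _).le

theorem intervalIntegrable_sub_rpow {α t : ℝ} (hα : 0 < α) :
    IntervalIntegrable (fun s => (t - s) ^ (α - 1)) MeasureTheory.volume 0 t := by
  have h := (intervalIntegral.intervalIntegrable_rpow' (a := 0) (b := t)
    (show -1 < α - 1 by linarith)).comp_sub_left t
  simpa using h.symm

theorem intervalIntegrable_sub_rpow_mul {α t C : ℝ} (hα : 0 < α) (ht : 0 ≤ t) {f : ℝ → ℝ}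
    (hf : Measurable f) (hC : ∀ u ∈ Set.Icc 0 t, |f u| ≤ C) :
    IntervalIntegrable (fun s => (t - s) ^ (α - 1) * f s) MeasureTheory.volume 0 t := by
  rw [intervalIntegrable_iff_integrableOn_Ioc_of_le ht]
  refine MeasureTheory.Integrable.mul_bdd (c := C)
    ((intervalIntegrable_iff_integrableOn_Ioc_of_le ht).1 (intervalIntegrable_sub_rpow hα))
    hf.aestronglyMeasurable ?_
  filter_upwards [MeasureTheory.self_mem_ae_restrict measurableSet_Ioc] with x hx
  exact hC x ⟨hx.1.le, hx.2⟩

theorem hasSum_rlInt {α t : ℝ} (hα : 0 < α) (ht : 0 ≤ t) {f : ℕ → ℝ → ℝ} {b : ℕ → ℝ}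
    (hf : ∀ k, Measurable (f k)) (hb : Summable b)
    (hfb : ∀ k, ∀ u ∈ Set.Icc 0 t, |f k u| ≤ b k) :
    HasSum (fun k => rlInt α (f k) t) (rlInt α (fun u => ∑' k, f k u) t) := by
  unfold rlInt
  refine HasSum.mul_left _ ?_
  refine intervalIntegral.hasSum_integral_of_dominated_convergence
    (fun k s => (t - s) ^ (α - 1) * b k) (fun k => ?_) (fun k => ?_) ?_ ?_ ?_
  · have := hf k
    exact Measurable.aestronglyMeasurable (by fun_prop)
  · filter_upwards with s hs
    rw [Set.uIoc_of_le ht] at hs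
    have h0 : 0 ≤ (t - s) ^ (α - 1) := Real.rpow_nonneg (by linarith [hs.2]) _
    rw [Real.norm_eq_abs, abs_mul, abs_of_nonneg h0]
    exact mul_le_mul_of_nonneg_left (hfb k s ⟨hs.1.le, hs.2⟩) h0
  · exact .of_forall fun s _ => hb.mul_left _
  · simpa only [tsum_mul_left] using (intervalIntegrable_sub_rpow hα).mul_const (∑' k, b k)
  · filter_upwards with s hs
    rw [Set.uIoc_of_le ht] at hs
    have hsum : Summable fun k => f k s :=
      Summable.of_norm_bounded hb fun k => hfb k s ⟨hs.1.le, hs.2⟩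
    exact hsum.hasSum.mul_left _

theorem rlInt_const_mul (α c : ℝ) (f : ℝ → ℝ) (t : ℝ) :
    rlInt α (fun u => c * f u) t = c * rlInt α f t := by
  simp only [rlInt, mul_left_comm _ c, intervalIntegral.integral_const_mul]

/-- The fractional integral of a normalised power. -/
theorem rlInt_rpow_div_Gamma {α s t : ℝ} (hα : 0 < α) (hs : 0 ≤ s) (ht : 0 < t) :
    rlInt α (fun u => u ^ s / Real.Gamma (1 + s)) t
      = t ^ (s + α) / Real.Gamma (1 + (s + α)) := by
  have hs1 : 0 < 1 + s := by linarith
  have hbeta : ∫ u in (0:ℝ)..t, (t - u) ^ (α - 1) * u ^ s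
      = t ^ (s + α) * ProbabilityTheory.beta (1 + s) α := by
    apply Complex.ofReal_injective
    have h := Complex.betaIntegral_scaled ((1 + s : ℝ) : ℂ) (α : ℂ) ht
    rw [Complex.betaIntegral_eq_Gamma_mul_div _ _ (by simpa using hs1) (by simpa using hα)] at h
    rw [← intervalIntegral.integral_ofReal, ProbabilityTheory.beta]
    push_cast [Complex.ofReal_cpow ht.le, ← Complex.Gamma_ofReal]
    convert h using 1
    · refine intervalIntegral.integral_congr fun u hu => ?_
      rw [Set.uIcc_of_le ht.le] at hu
      have h1 : ((t - u : ℝ) : ℂ) = t - u := by push_cast; rfl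
      simp only [← h1]
      rw [Complex.ofReal_cpow (sub_nonneg.2 hu.2), Complex.ofReal_cpow hu.1, mul_comm]
      push_cast
      ring_nf
    · push_cast
      ring_nf
  have hΓα := (Real.Gamma_pos_of_pos hα).ne'
  have hΓs := (Real.Gamma_pos_of_pos hs1).ne'
  simp only [rlInt, ← mul_div_assoc, intervalIntegral.integral_div, hbeta]
  rw [ProbabilityTheory.beta, add_assoc]
  field_simp

theorem rlInt_sum {ι : Type*} (S : Finset ι) {α t : ℝ} (hα : 0 < α) (ht : 0 ≤ t)
    {f : ι → ℝ → ℝ} {C : ι → ℝ} (hf : ∀ i ∈ S, Measurable (f i))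
    (hC : ∀ i ∈ S, ∀ u ∈ Set.Icc 0 t, |f i u| ≤ C i) :
    rlInt α (fun u => ∑ i ∈ S, f i u) t = ∑ i ∈ S, rlInt α (f i) t := by
  simp only [rlInt, Finset.mul_sum]
  rw [intervalIntegral.integral_finsetSum fun i hi =>
    intervalIntegrable_sub_rpow_mul hα ht (hf i hi) (hC i hi), Finset.mul_sum]

/-- The inner sum in the series `pI`. -/
noncomputable def thetaSum (α : ℕ → ℝ) (n k : ℕ) (u : ℝ) : ℝ :=
  ∑ κ ∈ Theta n k, u ^ (∑ j, (κ j : ℝ) * α j.val) / Real.Gamma (1 + ∑ j, (κ j : ℝ) * α j.val)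

theorem mem_Theta {n k : ℕ} {κ : Fin (n + 1) → ℕ} :
    κ ∈ Theta n k ↔ ∑ j, κ j = k ∧ ∀ j : Fin (n + 1), 1 ≤ j.val → 1 ≤ κ j := by
  simp [Theta, Finset.Nat.mem_antidiagonalTuple]

theorem card_Theta_le (n k : ℕ) : (Theta n k).card ≤ (k + 1) ^ (n + 1) := by
  have h : Theta n k ⊆ Fintype.piFinset fun _ : Fin (n + 1) => Finset.range (k + 1) := by
    intro κ hκ
    rw [mem_Theta] at hκ
    simp only [Fintype.mem_piFinset, Finset.mem_range, Nat.lt_succ_iff]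
    exact fun j => hκ.1 ▸ Finset.single_le_sum (fun _ _ => Nat.zero_le _) (Finset.mem_univ j)
  simpa using Finset.card_le_card h

theorem Theta_zero (k : ℕ) : Theta 0 k = {![k]} := by
  rw [Theta, Finset.Nat.antidiagonalTuple_one, Finset.filter_singleton, if_pos]
  intro j hj
  omega

theorem Theta_succ_zero (m : ℕ) : Theta (m + 1) 0 = ∅ := by
  refine Finset.eq_empty_of_forall_notMem fun κ hκ => ?_
  rw [mem_Theta] at hκ
  have h1 := hκ.2 (Fin.last _) (by simp)
  have h2 := (Finset.sum_eq_zero_iff.1 hκ.1) (Fin.last _) (Finset.mem_univ _)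
  omega

/-- Lowering the last entry by one sends `Theta (m + 1) (k + 1)` onto the disjoint union of
`Theta (m + 1) k` and `Theta m k`, the latter being the tuples whose last entry becomes zero. -/
theorem sum_Theta_succ_succ (α : ℕ → ℝ) (m k : ℕ) (F : ℝ → ℝ) :
    ∑ κ ∈ Theta (m + 1) (k + 1), F (∑ j, (κ j : ℝ) * α j.val)
      = ∑ κ ∈ Theta (m + 1) k, F ((∑ j, (κ j : ℝ) * α j.val) + α (m + 1))
        + ∑ κ ∈ Theta m k, F ((∑ j, (κ j : ℝ) * α j.val) + α (m + 1)) := by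
  rw [← Finset.sum_filter_add_sum_filter_not _ (fun κ => 2 ≤ κ (Fin.last (m + 1)))]
  congr 1
  · refine Finset.sum_nbij' (fun κ => Fin.snoc (α := fun _ => ℕ) (Fin.init κ) (κ (Fin.last _) - 1))
      (fun κ => Fin.snoc (α := fun _ => ℕ) (Fin.init κ) (κ (Fin.last _) + 1)) ?_ ?_ ?_ ?_ ?_
    · intro κ hκ
      simp only [Finset.mem_filter, mem_Theta, Fin.sum_univ_castSucc, Fin.forall_fin_succ',
        Fin.snoc_castSucc, Fin.snoc_last, Fin.init] at hκ ⊢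
      exact ⟨by omega, hκ.1.2.1, by omega⟩
    · intro κ hκ
      simp only [Finset.mem_filter, mem_Theta, Fin.sum_univ_castSucc, Fin.forall_fin_succ',
        Fin.snoc_castSucc, Fin.snoc_last, Fin.init, Fin.val_last] at hκ ⊢
      exact ⟨⟨by omega, hκ.2.1, by omega⟩, by omega⟩
    · intro κ hκ
      simp only [Finset.mem_filter] at hκ
      simp [Nat.sub_add_cancel (show 1 ≤ κ (Fin.last _) by omega)]
    · intro κ _
      simp
    · intro κ hκ
      simp only [Finset.mem_filter] at hκ
      rw [Fin.sum_univ_castSucc, Fin.sum_univ_castSucc (n := m + 1)]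
      simp only [Fin.snoc_castSucc, Fin.snoc_last, Fin.init, Fin.val_last]
      push_cast [show 1 ≤ κ (Fin.last _) by omega]
      ring_nf
  · refine Finset.sum_nbij' (fun κ => Fin.init (α := fun _ => ℕ) κ)
      (fun κ => Fin.snoc (α := fun _ => ℕ) κ 1) ?_ ?_ ?_ ?_ ?_
    · intro κ hκ
      simp only [Finset.mem_filter, mem_Theta, Fin.sum_univ_castSucc (n := m + 1),
        Fin.forall_fin_succ' (n := m + 1), Fin.init, Fin.val_last] at hκ ⊢
      exact ⟨by have := hκ.1.2.2; omega, hκ.1.2.1⟩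
    · intro κ hκ
      simp only [Finset.mem_filter, mem_Theta, Fin.sum_univ_castSucc (n := m + 1),
        Fin.forall_fin_succ' (n := m + 1), Fin.snoc_castSucc, Fin.snoc_last] at hκ ⊢
      exact ⟨⟨by omega, hκ.2, by omega⟩, by omega⟩
    · intro κ hκ
      simp only [Finset.mem_filter, mem_Theta] at hκ
      have h1 := hκ.1.2 (Fin.last _) (by simp)
      have h2 : κ (Fin.last _) = 1 := by omega
      simp [← h2]
    · intro κ _
      simp
    · intro κ hκ
      simp only [Finset.mem_filter, mem_Theta] at hκ
      have h1 := hκ.1.2 (Fin.last _) (by simp)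
      have h2 : κ (Fin.last _) = 1 := by omega
      rw [Fin.sum_univ_castSucc]
      simp [h2, Fin.init]

theorem measurable_thetaSum (α : ℕ → ℝ) (n k : ℕ) : Measurable (thetaSum α n k) := by
  unfold thetaSum
  fun_prop

theorem abs_rpow_div_Gamma_le {s t u : ℝ} (hs : 0 ≤ s) (hu : u ∈ Set.Icc 0 t) :
    |u ^ s / Real.Gamma (1 + s)| ≤ t ^ s / Real.Gamma (1 + s) := by
  have hΓ : 0 < Real.Gamma (1 + s) := Real.Gamma_pos_of_pos (by linarith)
  rw [abs_of_nonneg (div_nonneg (Real.rpow_nonneg hu.1 _) hΓ.le)]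
  gcongr
  exacts [hu.1, hu.2]

theorem sum_mul_order_nonneg {α : ℕ → ℝ} (hα : ∀ n, 0 < α n) {n : ℕ} (κ : Fin (n + 1) → ℕ) :
    0 ≤ ∑ j, (κ j : ℝ) * α j.val :=
  Finset.sum_nonneg fun _ _ => mul_nonneg (Nat.cast_nonneg _) (hα _).le

theorem rlInt_thetaSum {α : ℕ → ℝ} (hα : ∀ n, 0 < α n) {a t : ℝ} (ha : 0 < a) (ht : 0 < t)
    (n k : ℕ) :
    rlInt a (thetaSum α n k) t = ∑ κ ∈ Theta n k, t ^ ((∑ j, (κ j : ℝ) * α j.val) + a)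
      / Real.Gamma (1 + ((∑ j, (κ j : ℝ) * α j.val) + a)) := by
  have hbound : ∀ κ ∈ Theta n k, ∀ u ∈ Set.Icc 0 t,
      |u ^ (∑ j, (κ j : ℝ) * α j.val) / Real.Gamma (1 + ∑ j, (κ j : ℝ) * α j.val)|
        ≤ t ^ (∑ j, (κ j : ℝ) * α j.val) / Real.Gamma (1 + ∑ j, (κ j : ℝ) * α j.val) := by
    intro κ _ u hu
    have hs := sum_mul_order_nonneg hα κ
    exact abs_rpow_div_Gamma_le hs hu
  refine (rlInt_sum _ ha ht.le (fun κ _ => by fun_prop) hbound).trans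
    (Finset.sum_congr rfl fun κ _ => ?_)
  have hs := sum_mul_order_nonneg hα κ
  exact rlInt_rpow_div_Gamma ha hs ht

theorem thetaSum_zero_zero (α : ℕ → ℝ) (t : ℝ) : thetaSum α 0 0 t = 1 := by
  simp [thetaSum, Theta_zero]

theorem thetaSum_succ_zero (α : ℕ → ℝ) (m : ℕ) (t : ℝ) : thetaSum α (m + 1) 0 t = 0 := by
  simp [thetaSum, Theta_succ_zero]

theorem thetaSum_zero_succ {α : ℕ → ℝ} (hα : ∀ n, 0 < α n) {t : ℝ} (ht : 0 < t) (k : ℕ) :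
    thetaSum α 0 (k + 1) t = rlInt (α 0) (thetaSum α 0 k) t := by
  rw [rlInt_thetaSum hα (hα 0) ht, thetaSum, Theta_zero, Theta_zero]
  simp [add_mul]

theorem thetaSum_succ_succ {α : ℕ → ℝ} (hα : ∀ n, 0 < α n) {t : ℝ} (ht : 0 < t) (m k : ℕ) :
    thetaSum α (m + 1) (k + 1) t
      = rlInt (α (m + 1)) (thetaSum α (m + 1) k) t + rlInt (α (m + 1)) (thetaSum α m k) t := by
  rw [rlInt_thetaSum hα (hα _) ht, rlInt_thetaSum hα (hα _) ht]
  exact sum_Theta_succ_succ α m k fun s => t ^ s / Real.Gamma (1 + s)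

theorem exists_summable_bound_thetaSum {α : ℕ → ℝ} (hα : ∀ n, 0 < α n) {lam t : ℝ}
    (hlam : 0 < lam) (ht : 0 < t) (n : ℕ) :
    ∃ b : ℕ → ℝ, Summable b ∧
      ∀ k, ∀ u ∈ Set.Icc 0 t, |(-lam) ^ k * thetaSum α n k u| ≤ b k := by
  obtain ⟨i, -, hi⟩ := Finset.exists_min_image (Finset.univ : Finset (Fin (n + 1)))
    (fun j => α j.val) Finset.univ_nonempty
  have hx : ∃ x : ℝ, 0 < x ∧ x < 1 ∧ lam * x ^ α i.val < 1 / 2 := by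
    have hlim : Filter.Tendsto (fun x : ℝ => lam * x ^ α i.val) (nhdsWithin 0 (Set.Ioi 0))
        (nhds 0) := by
      have h := ((Real.continuous_rpow_const (hα i.val).le).const_mul lam).tendsto 0
      simp only [Real.zero_rpow (hα i.val).ne', mul_zero] at h
      exact h.mono_left nhdsWithin_le_nhds
    obtain ⟨x, hx1, hx2⟩ := ((hlim.eventually_lt_const (show (0:ℝ) < 1 / 2 by norm_num)).and
      (Ioo_mem_nhdsGT (show (0:ℝ) < 1 by norm_num))).exists
    exact ⟨x, hx2.1, hx2.2, hx1⟩
  obtain ⟨x, hx0, hx1, hx⟩ := hx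
  have hR : 0 < t / x := div_pos ht hx0
  refine ⟨fun k => ((k + 1 : ℕ) : ℝ) ^ (n + 1) * (1 / 2) ^ (k + 1) * (2 * Real.exp (t / x)),
    ?_, fun k u hu => ?_⟩
  · exact (((summable_nat_add_iff 1).2 (summable_pow_mul_geometric_of_norm_lt_one (R := ℝ)
      (r := 1 / 2) (n + 1) (by norm_num))).mul_right _)
  · have hterm : ∀ κ ∈ Theta n k,
        |(-lam) ^ k * (u ^ (∑ j, (κ j : ℝ) * α j.val)
          / Real.Gamma (1 + ∑ j, (κ j : ℝ) * α j.val))| ≤ (1 / 2) ^ k * Real.exp (t / x) := by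
      intro κ hκ
      have hs := sum_mul_order_nonneg hα κ
      have hks : α i.val * k ≤ ∑ j, (κ j : ℝ) * α j.val := by
        rw [← (mem_Theta.1 hκ).1, Nat.cast_sum, mul_comm, Finset.sum_mul]
        exact Finset.sum_le_sum fun j hj =>
          mul_le_mul_of_nonneg_left (hi j hj) (Nat.cast_nonneg _)
      set s := ∑ j, (κ j : ℝ) * α j.val
      rw [abs_mul, abs_pow, abs_neg, abs_of_pos hlam]
      calc lam ^ k * |u ^ s / Real.Gamma (1 + s)|
          ≤ lam ^ k * (t ^ s / Real.Gamma (1 + s)) := by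
            gcongr
            exact abs_rpow_div_Gamma_le hs hu
        _ = lam ^ k * (x ^ s * ((t / x) ^ s / Real.Gamma (1 + s))) := by
            rw [← mul_div_assoc (x ^ s), ← Real.mul_rpow hx0.le hR.le, mul_div_cancel₀ _ hx0.ne']
        _ ≤ lam ^ k * (x ^ (α i.val * k) * Real.exp (t / x)) := by
            have h1 := rpow_div_Gamma_le_exp hR hs
            have h2 := Real.rpow_le_rpow_of_exponent_ge hx0 hx1.le hks
            gcongr
        _ = (lam * x ^ α i.val) ^ k * Real.exp (t / x) := by
            rw [mul_pow, Real.rpow_mul hx0.le, Real.rpow_natCast, mul_assoc]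
        _ ≤ (1 / 2) ^ k * Real.exp (t / x) := by gcongr
    rw [thetaSum, Finset.mul_sum]
    calc _ ≤ _ := Finset.abs_sum_le_sum_abs _ _
      _ ≤ (Theta n k).card • ((1 / 2) ^ k * Real.exp (t / x)) := Finset.sum_le_card_nsmul _ _ _ hterm
      _ ≤ ((k + 1 : ℕ) : ℝ) ^ (n + 1) * ((1 / 2) ^ k * Real.exp (t / x)) := by
          rw [nsmul_eq_mul]
          gcongr
          exact_mod_cast card_Theta_le n k
      _ = _ := by dsimp only; ring

theorem pI_eq_tsum_thetaSum (lam : ℝ) (α : ℕ → ℝ) (n : ℕ) (t : ℝ) :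
    pI lam α n t = (-1 : ℝ) ^ n * ∑' k : ℕ, (-lam) ^ k * thetaSum α n k t := rfl

theorem summable_thetaSum {α : ℕ → ℝ} (hα : ∀ n, 0 < α n) {lam t : ℝ} (hlam : 0 < lam)
    (ht : 0 < t) (n : ℕ) : Summable fun k => (-lam) ^ k * thetaSum α n k t := by
  obtain ⟨b, hb, hbound⟩ := exists_summable_bound_thetaSum hα hlam ht n
  exact Summable.of_norm_bounded hb fun k => hbound k t ⟨ht.le, le_rfl⟩

theorem hasSum_rlInt_thetaSum {α : ℕ → ℝ} (hα : ∀ n, 0 < α n) {lam a t : ℝ} (hlam : 0 < lam)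
    (ha : 0 < a) (ht : 0 < t) (n : ℕ) :
    HasSum (fun k => (-lam) ^ k * rlInt a (thetaSum α n k) t)
      ((-1) ^ n * rlInt a (pI lam α n) t) := by
  obtain ⟨b, hb, hbound⟩ := exists_summable_bound_thetaSum hα hlam ht n
  have h := hasSum_rlInt ha ht.le (fun k => (measurable_thetaSum α n k).const_mul _) hb hbound
  simp only [rlInt_const_mul] at h
  convert h using 1
  rw [← rlInt_const_mul]
  congr 1
  ext u
  rw [pI_eq_tsum_thetaSum, ← mul_assoc, ← mul_pow]
  simp

theorem pI_at_zero {α : ℕ → ℝ} (hα : ∀ n, 0 < α n) (lam : ℝ) (n : ℕ) :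
    pI lam α n 0 = if n = 0 then 1 else 0 := by
  have hzero : ∀ k, thetaSum α n (k + 1) 0 = 0 := by
    intro k
    refine Finset.sum_eq_zero fun κ hκ => ?_
    have hpos : 0 < ∑ j, (κ j : ℝ) * α j.val := by
      obtain ⟨j, hj, hj0⟩ := Finset.exists_ne_zero_of_sum_ne_zero
        (show ∑ j, κ j ≠ 0 by rw [(mem_Theta.1 hκ).1]; omega)
      exact Finset.sum_pos' (fun _ _ => mul_nonneg (Nat.cast_nonneg _) (hα _).le)
        ⟨j, hj, mul_pos (by positivity) (hα _)⟩
    rw [Real.zero_rpow hpos.ne', zero_div]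
  rw [pI_eq_tsum_thetaSum, tsum_eq_single 0]
  · cases n with
    | zero => simp [thetaSum_zero_zero]
    | succ m => simp [thetaSum_succ_zero]
  · intro k hk
    obtain ⟨k, rfl⟩ := Nat.exists_eq_succ_of_ne_zero hk
    rw [hzero, mul_zero]

/-- The SDTFPP-I state probabilities solve the Riemann–Liouville integral form of the
governing difference-differential equations. -/
theorem sdtfppI_integral_equation (lam : ℝ) (hlam : 0 < lam)
    (α : ℕ → ℝ) (hα : ∀ n, 0 < α n ∧ α n ≤ 1)
    (n : ℕ) (t : ℝ) (ht : 0 ≤ t) :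
    pI lam α n t
      = (if n = 0 then (1:ℝ) else 0)
        - lam * rlInt (α n) (fun u => pI lam α n u) t
        + lam * rlInt (α n) (fun u => if n = 0 then (0:ℝ) else pI lam α (n - 1) u) t := by
  have hα0 : ∀ n, 0 < α n := fun n => (hα n).1
  rcases ht.eq_or_lt with rfl | ht
  · simp [pI_at_zero hα0, rlInt]
  have hn := (hasSum_rlInt_thetaSum hα0 hlam (hα0 n) ht n).mul_left (-lam)
  rw [pI_eq_tsum_thetaSum, (summable_thetaSum hα0 hlam ht n).tsum_eq_zero_add]
  cases n with
  | zero =>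
    simp only [thetaSum_zero_succ hα0 ht, pow_succ', mul_assoc, hn.tsum_eq, thetaSum_zero_zero]
    simp [rlInt, sub_eq_add_neg]
  | succ m =>
    have hm := (hasSum_rlInt_thetaSum hα0 hlam (hα0 (m + 1)) ht m).mul_left (-lam)
    simp only [thetaSum_succ_succ hα0 ht, pow_succ' (-lam), mul_assoc, mul_add,
      (hn.add hm).tsum_eq, thetaSum_succ_zero]
    have hsign : (-1 : ℝ) ^ m * (-1) ^ m = 1 := by rw [← mul_pow]; simp
    simp only [Nat.add_sub_cancel, if_neg (Nat.succ_ne_zero m)]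
    linear_combination (lam * rlInt (α (m + 1)) (pI lam α m) t
      - lam * rlInt (α (m + 1)) (pI lam α (m + 1)) t) * hsign
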